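/- For μ ∈ ℂ with Re(μ) > (q−1)/2, the Laplace transform identity ∫_{Π_q} e^{−⟨x,y⟩} det(x)^{μ − (q+1)/2} dx = Γ_Ω(μ) · det(y)^{−μ} holds for every real positive definite symmetric q×q matrix y, where Γ_Ω(μ) = π^{q(q−1)/4} ∏_{j=1}^{q} Γ(μ − (j−1)/2) and ⟨x,y⟩ = tr(xy). -/

import Mathlib

open Matrix MeasureTheory Complex

/-- Index of the upper-triangular coordinates of a symmetric `q×q` matrix. -/
abbrev SymIdx (q : ℕ) := {p : Fin q × Fin q // p.1 ≤ p.2}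

/-- The symmetric matrix with the given upper-triangular coordinates. -/
noncomputable def toSym (q : ℕ) (c : SymIdx q → ℝ) : Matrix (Fin q) (Fin q) ℝ :=
  fun i j => if h : i ≤ j then c ⟨(i, j), h⟩ else c ⟨(j, i), (not_le.mp h).le⟩

noncomputable instance matrixMeasureSpace (q : ℕ) :
    MeasureSpace (Matrix (Fin q) (Fin q) ℝ) :=
  inferInstanceAs (MeasureSpace (Fin q → Fin q → ℝ))

/-- Lebesgue measure on the space of real symmetric `q×q` matrices
(`dx = ∏_{i ≤ j} dx_{ij}`), realized as a measure on the matrix space. -/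
noncomputable def symMeasure (q : ℕ) : Measure (Matrix (Fin q) (Fin q) ℝ) :=
  Measure.map (toSym q) volume

/-- The gamma function `Γ_Ω` of the cone of positive definite real symmetric
`q×q` matrices: `Γ_Ω(μ) = π^{q(q−1)/4} ∏_{j=1}^q Γ(μ − (j−1)/2)`. -/
noncomputable def GammaOmegaC (q : ℕ) (μ : ℂ) : ℂ :=
  (Real.pi : ℂ) ^ (((q * (q - 1) : ℕ) : ℂ) / 4) *
    ∏ j ∈ Finset.range q, Complex.Gamma (μ - (j : ℂ) / 2)


/-- The block decomposition of the index set of a matrix of size `n + 1`. -/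
noncomputable def headTailEquiv (n : ℕ) : Unit ⊕ Fin n ≃ Fin (n + 1) :=
  Equiv.ofBijective (Sum.elim (fun _ => 0) Fin.succ) (by
    constructor
    · rintro (i | i) (j | j) h
      · rfl
      · exact absurd h.symm (Fin.succ_ne_zero j)
      · exact absurd h (Fin.succ_ne_zero i)
      · exact congrArg _ (Fin.succ_injective _ h)
    · intro i
      cases i using Fin.cases with
      | zero => exact ⟨.inl (), rfl⟩
      | succ i => exact ⟨.inr i, rfl⟩)

/-- The upper-triangular indices of size `n + 1` are those of the first row together with those
of the lower-right block. -/
noncomputable def symIdxSuccEquiv (n : ℕ) : Fin (n + 1) ⊕ SymIdx n ≃ SymIdx (n + 1) :=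
  Equiv.ofBijective
    (Sum.elim (fun j => ⟨(0, j), Fin.zero_le j⟩)
      (fun p => ⟨(p.1.1.succ, p.1.2.succ), Fin.succ_le_succ_iff.mpr p.2⟩)) (by
    constructor
    · rintro (i | ⟨⟨i, i'⟩, hi⟩) (j | ⟨⟨j, j'⟩, hj⟩) h <;>
        simp only [Sum.elim_inl, Sum.elim_inr, Subtype.mk.injEq, Prod.mk.injEq] at h
      · rw [h.2]
      · exact absurd h.1.symm (Fin.succ_ne_zero j)
      · exact absurd h.1 (Fin.succ_ne_zero i)
      · have h1 := Fin.succ_injective _ h.1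
        have h2 := Fin.succ_injective _ h.2
        subst h1 h2
        rfl
    · rintro ⟨⟨i, j⟩, h⟩
      cases i using Fin.cases with
      | zero => exact ⟨.inl j, rfl⟩
      | succ i =>
        cases j using Fin.cases with
        | zero => exact absurd h (by simp)
        | succ j => exact ⟨.inr ⟨(i, j), Fin.succ_le_succ_iff.mp h⟩, rfl⟩)

/-- The coordinates of a symmetric matrix of size `n + 1`, built from its corner entry, the rest
of its first row, and its lower-right block. -/
noncomputable def glueSym (n : ℕ) :
    (ℝ × (Fin n → ℝ)) × (SymIdx n → ℝ) ≃ᵐ (SymIdx (n + 1) → ℝ) :=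
  ((MeasurableEquiv.prodCongr (MeasurableEquiv.piFinSuccAbove (fun _ => ℝ) 0).symm
    (MeasurableEquiv.refl _)).trans
      (MeasurableEquiv.sumPiEquivProdPi (fun _ : Fin (n + 1) ⊕ SymIdx n => ℝ)).symm).trans
    (MeasurableEquiv.piCongrLeft (fun _ => ℝ) (symIdxSuccEquiv n))

theorem measurePreserving_glueSym (n : ℕ) : MeasurePreserving (glueSym n) := by
  have h₁ := (volume_preserving_piFinSuccAbove (fun _ : Fin (n + 1) => ℝ) 0).symm
  have h₂ := h₁.prod (MeasurePreserving.id (volume : Measure (SymIdx n → ℝ)))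
  have h₃ := volume_measurePreserving_sumPiEquivProdPi_symm
    (fun _ : Fin (n + 1) ⊕ SymIdx n => ℝ)
  have h₄ := volume_measurePreserving_piCongrLeft (fun _ => ℝ) (symIdxSuccEquiv n)
  exact h₄.comp (h₃.comp h₂)

theorem glueSym_inl (n : ℕ) (p : (ℝ × (Fin n → ℝ)) × (SymIdx n → ℝ)) (j : Fin (n + 1)) :
    glueSym n p ⟨(0, j), Fin.zero_le j⟩ = (Fin.cons p.1.1 p.1.2 : Fin (n + 1) → ℝ) j := by
  change glueSym n p (symIdxSuccEquiv n (.inl j)) = _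
  simp only [glueSym, MeasurableEquiv.trans_apply]
  rw [MeasurableEquiv.piCongrLeft_apply_apply]
  change (Fin.insertNth 0 p.1.1 p.1.2 : Fin (n + 1) → ℝ) j = _
  rw [Fin.insertNth_zero']

theorem glueSym_inr (n : ℕ) (p : (ℝ × (Fin n → ℝ)) × (SymIdx n → ℝ)) (k : SymIdx n) :
    glueSym n p ⟨(k.1.1.succ, k.1.2.succ), Fin.succ_le_succ_iff.mpr k.2⟩ = p.2 k := by
  change glueSym n p (symIdxSuccEquiv n (.inr k)) = _
  simp only [glueSym, MeasurableEquiv.trans_apply]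
  rw [MeasurableEquiv.piCongrLeft_apply_apply]
  rfl

theorem toSym_glueSym_zero_zero (n : ℕ) (p : (ℝ × (Fin n → ℝ)) × (SymIdx n → ℝ)) :
    toSym (n + 1) (glueSym n p) 0 0 = p.1.1 := by
  simpa [toSym] using glueSym_inl n p 0

theorem toSym_glueSym_zero_succ (n : ℕ) (p : (ℝ × (Fin n → ℝ)) × (SymIdx n → ℝ)) (j : Fin n) :
    toSym (n + 1) (glueSym n p) 0 j.succ = p.1.2 j := by
  simpa [toSym] using glueSym_inl n p j.succ

theorem toSym_glueSym_succ_zero (n : ℕ) (p : (ℝ × (Fin n → ℝ)) × (SymIdx n → ℝ)) (j : Fin n) :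
    toSym (n + 1) (glueSym n p) j.succ 0 = p.1.2 j := by
  simpa [toSym] using glueSym_inl n p j.succ

theorem toSym_glueSym_succ_succ (n : ℕ) (p : (ℝ × (Fin n → ℝ)) × (SymIdx n → ℝ))
    (i j : Fin n) :
    toSym (n + 1) (glueSym n p) i.succ j.succ = toSym n p.2 i j := by
  by_cases h : i ≤ j
  · simpa [toSym, h] using glueSym_inr n p ⟨(i, j), h⟩
  · simpa [toSym, h] using glueSym_inr n p ⟨(j, i), (not_le.mp h).le⟩

theorem toSym_glueSym_submatrix (n : ℕ) (p : (ℝ × (Fin n → ℝ)) × (SymIdx n → ℝ)) :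
    (toSym (n + 1) (glueSym n p)).submatrix (headTailEquiv n) (headTailEquiv n) =
      fromBlocks (of fun _ _ : Unit => p.1.1) (of fun (_ : Unit) j => p.1.2 j)
        (of fun (_ : Unit) j => p.1.2 j)ᴴ (toSym n p.2) := by
  ext (i | i) (j | j)
  · exact toSym_glueSym_zero_zero n p
  · exact toSym_glueSym_zero_succ n p j
  · exact toSym_glueSym_succ_zero n p i
  · exact toSym_glueSym_succ_succ n p i j

/-- The coordinates of the rank one matrix `a⁻¹ b bᵀ`. -/
noncomputable def rankOneCoord (n : ℕ) (u : ℝ × (Fin n → ℝ)) : SymIdx n → ℝ :=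
  fun k => u.1⁻¹ * (u.2 k.1.1 * u.2 k.1.2)

theorem toSym_add_rankOneCoord (n : ℕ) (u : ℝ × (Fin n → ℝ)) (S : SymIdx n → ℝ) (i j : Fin n) :
    toSym n (S + rankOneCoord n u) i j = toSym n S i j + u.1⁻¹ * (u.2 i * u.2 j) := by
  by_cases h : i ≤ j
  · simp [toSym, h, rankOneCoord]
  · simp [toSym, h, rankOneCoord, mul_comm]

/-- The inverse of the Schur complement parametrization of symmetric matrices. -/
noncomputable def schurMap (n : ℕ) (p : (ℝ × (Fin n → ℝ)) × (SymIdx n → ℝ)) :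
    SymIdx (n + 1) → ℝ :=
  glueSym n (p.1, p.2 + rankOneCoord n p.1)

theorem measurePreserving_schurMap (n : ℕ) : MeasurePreserving (schurMap n) := by
  have h : Measurable (rankOneCoord n) := by
    unfold rankOneCoord
    fun_prop
  have h₁ := (MeasurePreserving.id (volume : Measure (ℝ × (Fin n → ℝ)))).skew_product
    (g := fun u S => S + rankOneCoord n u) (μc := (volume : Measure (SymIdx n → ℝ)))
    (μd := volume) (by unfold Function.uncurry; fun_prop)
    (.of_forall fun u => map_add_right_eq_self volume (rankOneCoord n u))
  exact (measurePreserving_glueSym n).comp h₁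

theorem schurMap_submatrix (n : ℕ) (p : (ℝ × (Fin n → ℝ)) × (SymIdx n → ℝ)) :
    (toSym (n + 1) (schurMap n p)).submatrix (headTailEquiv n) (headTailEquiv n) =
      fromBlocks (of fun _ _ : Unit => p.1.1) (of fun (_ : Unit) j => p.1.2 j)
        (of fun (_ : Unit) j => p.1.2 j)ᴴ (toSym n (p.2 + rankOneCoord n p.1)) :=
  toSym_glueSym_submatrix n _

theorem schur_complement_schurMap (n : ℕ) (p : (ℝ × (Fin n → ℝ)) × (SymIdx n → ℝ)) :
    toSym n (p.2 + rankOneCoord n p.1) - (of fun (_ : Unit) j => p.1.2 j)ᴴ *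
      (of fun _ _ : Unit => p.1.1)⁻¹ * (of fun (_ : Unit) j => p.1.2 j) = toSym n p.2 := by
  ext i j
  rw [Matrix.sub_apply, toSym_add_rankOneCoord]
  simp only [mul_apply, Matrix.inv_subsingleton, conjTranspose_apply, of_apply, star_trivial,
    Finset.univ_unique, Finset.sum_singleton, Ring.inverse_eq_inv', diagonal_apply_eq]
  ring

theorem det_schurMap (n : ℕ) (p : (ℝ × (Fin n → ℝ)) × (SymIdx n → ℝ)) (hp : p.1.1 ≠ 0) :
    (toSym (n + 1) (schurMap n p)).det = p.1.1 * (toSym n p.2).det := by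
  rw [← det_submatrix_equiv_self (headTailEquiv n), schurMap_submatrix]
  have : IsUnit (of fun _ _ : Unit => p.1.1 : Matrix Unit Unit ℝ).det := by simpa using hp
  let := invertibleOfIsUnitDet _ this
  rw [det_fromBlocks₁₁, invOf_eq_nonsing_inv, schur_complement_schurMap]
  simp

theorem posSemidef_schurMap (n : ℕ) (p : (ℝ × (Fin n → ℝ)) × (SymIdx n → ℝ)) (hp : p.1.1 ≠ 0) :
    (toSym (n + 1) (schurMap n p)).PosSemidef ↔ 0 < p.1.1 ∧ (toSym n p.2).PosSemidef := by
  have h0 (h : 0 < p.1.1) : (toSym (n + 1) (schurMap n p)).PosSemidef ↔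
      (toSym n p.2).PosSemidef := by
    have hA : (of fun _ _ : Unit => p.1.1 : Matrix Unit Unit ℝ).PosDef := by
      convert Matrix.PosDef.diagonal (d := fun _ : Unit => p.1.1) (fun _ => h)
      ext
      simp
    let := invertibleOfIsUnitDet _ hA.det_pos.ne'.isUnit
    rw [← posSemidef_submatrix_equiv (headTailEquiv n), schurMap_submatrix,
      PosDef.fromBlocks₁₁ _ _ hA, schur_complement_schurMap]
  constructor
  · intro h
    have h1 : 0 ≤ p.1.1 := by
      simpa [schurMap, toSym_glueSym_zero_zero] using h.diag_nonneg (i := 0)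
    have h2 := lt_of_le_of_ne h1 hp.symm
    exact ⟨h2, (h0 h2).mp h⟩
  · rintro ⟨h, h'⟩
    exact (h0 h).mpr h'

theorem trace_schurMap_mul (n : ℕ) (p : (ℝ × (Fin n → ℝ)) × (SymIdx n → ℝ))
    (y : Matrix (Fin (n + 1)) (Fin (n + 1)) ℝ) (hy : y.IsSymm) :
    (toSym (n + 1) (schurMap n p) * y).trace =
      (p.1.1 * y 0 0 + 2 * (p.1.2 ⬝ᵥ fun i => y i.succ 0) +
        p.1.1⁻¹ * (p.1.2 ⬝ᵥ y.submatrix Fin.succ Fin.succ *ᵥ p.1.2)) +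
      (toSym n p.2 * y.submatrix Fin.succ Fin.succ).trace := by
  have hs (i : Fin n) : y 0 i.succ = y i.succ 0 := hy.apply _ _
  have hs' (i j : Fin n) : y j.succ i.succ = y i.succ j.succ := hy.apply _ _
  simp only [schurMap, trace, diag_apply, mul_apply, Fin.sum_univ_succ, toSym_glueSym_zero_zero,
    toSym_glueSym_zero_succ, toSym_glueSym_succ_zero, toSym_glueSym_succ_succ,
    toSym_add_rankOneCoord, dotProduct, mulVec, submatrix_apply, hs, add_mul,
    Finset.sum_add_distrib, Finset.mul_sum]
  have : ∑ i, ∑ j, p.1.1⁻¹ * (p.1.2 i * p.1.2 j) * y j.succ i.succ =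
      ∑ i, ∑ j, p.1.1⁻¹ * (p.1.2 i * (y i.succ j.succ * p.1.2 j)) :=
    Finset.sum_congr rfl fun i _ => Finset.sum_congr rfl fun j _ => by rw [hs' i j]; ring
  rw [this, ← Finset.mul_sum]
  ring

theorem Matrix.PosDef.integral_exp_neg_quadratic {n : ℕ} {M : Matrix (Fin n) (Fin n) ℝ}
    (hM : M.PosDef) (s : ℝ) (v : Fin n → ℝ) :
    ∫ b : Fin n → ℝ, Real.exp (-(s * ((b + v) ⬝ᵥ M *ᵥ (b + v)))) =
      √(Real.pi / s) ^ n * (√M.det)⁻¹ := by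
  obtain ⟨B, hB, rfl⟩ : ∃ B : Matrix (Fin n) (Fin n) ℝ, IsUnit B ∧ M = Bᴴ * B := by
    open scoped MatrixOrder Matrix.Norms.L2Operator in
    obtain ⟨B, hB, h⟩ := CStarAlgebra.isStrictlyPositive_iff_eq_star_mul_self.mp
      hM.isStrictlyPositive
    exact ⟨B, hB, h⟩
  have hdet : B.det ≠ 0 := ((isUnit_iff_isUnit_det B).mp hB).ne_zero
  have hquad (b : Fin n → ℝ) :
      Real.exp (-(s * (b ⬝ᵥ (Bᴴ * B) *ᵥ b))) = ∏ i, Real.exp (-s * (toLin' B b) i ^ 2) := by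
    rw [← Real.exp_sum, ← mulVec_mulVec, dotProduct_mulVec, conjTranspose_eq_transpose_of_trivial,
      vecMul_transpose, dotProduct, Finset.mul_sum, ← Finset.sum_neg_distrib]
    simp only [toLin'_apply, pow_two, neg_mul]
  rw [integral_add_right_eq_self (fun b => Real.exp (-(s * (b ⬝ᵥ (Bᴴ * B) *ᵥ b))))]
  simp_rw [hquad]
  have hL : Measurable (toLin' B) := (LinearMap.continuous_on_pi _).measurable
  rw [← integral_map (f := fun x : Fin n → ℝ => ∏ i, Real.exp (-s * x i ^ 2)) hL.aemeasurable
    (Continuous.aestronglyMeasurable (by fun_prop)),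
    Real.map_matrix_volume_pi_eq_smul_volume_pi hdet, integral_smul_measure,
    integral_fintype_prod_volume_eq_pow (fun x : ℝ => Real.exp (-s * x ^ 2)), integral_gaussian,
    ENNReal.toReal_ofReal (abs_nonneg _), Fintype.card_fin, det_mul, det_conjTranspose,
    star_trivial, ← sq, Real.sqrt_sq_eq_abs, abs_inv, smul_eq_mul, mul_comm]

theorem Complex.integrableOn_cpow_mul_exp_neg_mul_Ioi {a : ℂ} {r : ℝ} (ha : 0 < a.re)
    (hr : 0 < r) :
    IntegrableOn (fun t : ℝ => (t : ℂ) ^ (a - 1) * Complex.exp (-(r * t))) (Set.Ioi 0) := by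
  apply Integrable.of_integral_ne_zero
  rw [Complex.integral_cpow_mul_exp_neg_mul_Ioi ha hr]
  refine mul_ne_zero ?_ (Complex.Gamma_ne_zero_of_re_pos ha)
  rw [Complex.cpow_ne_zero_iff]
  left
  simp [hr.ne']

/-- The part of the Laplace transform integrand that depends on the first row `(a, b)`. -/
noncomputable def firstRowFun {n : ℕ} (ν : ℂ) (c : ℝ) (w : Fin n → ℝ)
    (M : Matrix (Fin n) (Fin n) ℝ) (p : ℝ × (Fin n → ℝ)) : ℂ :=
  Set.indicator (Set.Ioi 0) (fun a : ℝ => (a : ℂ) ^ ν) p.1 *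
    (Real.exp (-(p.1 * c + 2 * (p.2 ⬝ᵥ w) + p.1⁻¹ * (p.2 ⬝ᵥ M *ᵥ p.2))) : ℝ)

theorem measurable_firstRowFun {n : ℕ} (ν : ℂ) (c : ℝ) (w : Fin n → ℝ)
    (M : Matrix (Fin n) (Fin n) ℝ) : Measurable (firstRowFun ν c w M) := by
  have h : Measurable (Set.indicator (Set.Ioi 0) (fun a : ℝ => (a : ℂ) ^ ν)) :=
    (Complex.measurable_ofReal.pow_const ν).indicator measurableSet_Ioi
  unfold firstRowFun dotProduct mulVec dotProduct
  fun_prop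

theorem exp_neg_firstRow {n : ℕ} {M : Matrix (Fin n) (Fin n) ℝ} (hM : M.PosDef) (c : ℝ)
    (w b : Fin n → ℝ) {a : ℝ} (ha : 0 < a) :
    Real.exp (-(a * c + 2 * (b ⬝ᵥ w) + a⁻¹ * (b ⬝ᵥ M *ᵥ b))) =
      Real.exp (-((c - w ⬝ᵥ M⁻¹ *ᵥ w) * a)) *
        Real.exp (-(a⁻¹ * ((b + a • M⁻¹ *ᵥ w) ⬝ᵥ M *ᵥ (b + a • M⁻¹ *ᵥ w)))) := by
  have hu : M *ᵥ (M⁻¹ *ᵥ w) = w := by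
    rw [mulVec_mulVec, mul_nonsing_inv _ hM.det_pos.ne'.isUnit, one_mulVec]
  have hsymm : (M⁻¹ *ᵥ w) ⬝ᵥ M *ᵥ b = b ⬝ᵥ w := by
    have : M.IsSymm := hM.isHermitian
    rw [dotProduct_mulVec, ← mulVec_transpose, this.eq, hu, dotProduct_comm]
  rw [← Real.exp_add, mulVec_add, mulVec_smul, hu, add_dotProduct, dotProduct_add, dotProduct_add,
    smul_dotProduct, smul_dotProduct, dotProduct_smul, dotProduct_smul, hsymm,
    dotProduct_comm (M⁻¹ *ᵥ w) w]
  congr 1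
  simp only [smul_eq_mul]
  field_simp
  ring

theorem integral_exp_neg_firstRow {n : ℕ} {M : Matrix (Fin n) (Fin n) ℝ} (hM : M.PosDef) (c : ℝ)
    (w : Fin n → ℝ) {a : ℝ} (ha : 0 < a) :
    ∫ b : Fin n → ℝ, Real.exp (-(a * c + 2 * (b ⬝ᵥ w) + a⁻¹ * (b ⬝ᵥ M *ᵥ b))) =
      Real.exp (-((c - w ⬝ᵥ M⁻¹ *ᵥ w) * a)) * (√a ^ n * (√Real.pi ^ n * (√M.det)⁻¹)) := by
  simp_rw [exp_neg_firstRow hM c w _ ha]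
  rw [integral_const_mul, hM.integral_exp_neg_quadratic, div_inv_eq_mul,
    Real.sqrt_mul Real.pi_pos.le]
  ring

theorem integrable_exp_neg_firstRow {n : ℕ} {M : Matrix (Fin n) (Fin n) ℝ} (hM : M.PosDef)
    (c : ℝ) (w : Fin n → ℝ) {a : ℝ} (ha : 0 < a) :
    Integrable fun b : Fin n → ℝ =>
      Real.exp (-(a * c + 2 * (b ⬝ᵥ w) + a⁻¹ * (b ⬝ᵥ M *ᵥ b))) := by
  apply Integrable.of_integral_ne_zero
  rw [integral_exp_neg_firstRow hM c w ha]
  have := hM.det_pos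
  have := Real.pi_pos
  positivity

theorem Complex.ofReal_sqrt_pow {a : ℝ} (ha : 0 ≤ a) (n : ℕ) :
    ((√a ^ n : ℝ) : ℂ) = (a : ℂ) ^ ((n : ℂ) / 2) := by
  rw [Real.sqrt_eq_rpow, ← Real.rpow_natCast, ← Real.rpow_mul ha, Complex.ofReal_cpow ha]
  congr 1
  push_cast
  ring

theorem integral_firstRowFun_snd {n : ℕ} {M : Matrix (Fin n) (Fin n) ℝ} (hM : M.PosDef) (μ : ℂ)
    (c : ℝ) (w : Fin n → ℝ) (a : ℝ) :
    ∫ b, firstRowFun (μ - ((n : ℂ) + 2) / 2) c w M (a, b) =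
      Set.indicator (Set.Ioi 0) (fun a : ℝ => ((√Real.pi ^ n * (√M.det)⁻¹ : ℝ) : ℂ) *
        ((a : ℂ) ^ (μ - 1) * Complex.exp (-((c - w ⬝ᵥ M⁻¹ *ᵥ w : ℝ) * a)))) a := by
  simp only [firstRowFun]
  rw [integral_const_mul, integral_complex_ofReal]
  by_cases ha : 0 < a
  · have ha' : (a : ℂ) ≠ 0 := by exact_mod_cast ha.ne'
    rw [Set.indicator_of_mem (Set.mem_Ioi.mpr ha), Set.indicator_of_mem (Set.mem_Ioi.mpr ha)]
    rw [integral_exp_neg_firstRow hM c w ha, show μ - 1 = (μ - ((n : ℂ) + 2) / 2) + n / 2 by ring,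
      Complex.cpow_add _ _ ha', ← Complex.ofReal_sqrt_pow ha.le]
    push_cast
    ring
  · rw [Set.indicator_of_notMem (by simpa using ha), Set.indicator_of_notMem (by simpa using ha),
      zero_mul]

theorem integrable_firstRowFun {n : ℕ} {M : Matrix (Fin n) (Fin n) ℝ} (hM : M.PosDef) {μ : ℂ}
    (hμ : 0 < μ.re) {c : ℝ} {w : Fin n → ℝ} (hc : 0 < c - w ⬝ᵥ M⁻¹ *ᵥ w) :
    Integrable (firstRowFun (μ - ((n : ℂ) + 2) / 2) c w M) := by
  refine (integrable_prod_iff (measurable_firstRowFun _ _ _ _).aestronglyMeasurable).mpr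
    ⟨.of_forall fun a => ?_, ?_⟩
  · by_cases ha : 0 < a
    · simp only [firstRowFun]
      exact (integrable_exp_neg_firstRow hM c w ha).ofReal (𝕜 := ℂ) |>.const_mul _
    · simp [firstRowFun, ha]
  · have h (a : ℝ) : ∫ b, ‖firstRowFun (μ - ((n : ℂ) + 2) / 2) c w M (a, b)‖ =
        ‖∫ b, firstRowFun (μ - ((n : ℂ) + 2) / 2) c w M (a, b)‖ := by
      simp only [firstRowFun, norm_mul, Complex.norm_real, Real.norm_eq_abs, Real.abs_exp]
      rw [integral_const_mul, integral_const_mul, integral_complex_ofReal, norm_mul, Complex.norm_real,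
        Real.norm_of_nonneg (integral_nonneg fun b => (Real.exp_pos _).le)]
    simp_rw [h, integral_firstRowFun_snd hM]
    exact ((integrable_indicator_iff measurableSet_Ioi).mpr
      ((Complex.integrableOn_cpow_mul_exp_neg_mul_Ioi hμ hc).const_mul _)).norm

theorem integral_firstRowFun {n : ℕ} {M : Matrix (Fin n) (Fin n) ℝ} (hM : M.PosDef) {μ : ℂ}
    (hμ : 0 < μ.re) {c : ℝ} {w : Fin n → ℝ} (hc : 0 < c - w ⬝ᵥ M⁻¹ *ᵥ w) :
    ∫ p, firstRowFun (μ - ((n : ℂ) + 2) / 2) c w M p =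
      ((√Real.pi ^ n * (√M.det)⁻¹ : ℝ) : ℂ) *
        ((1 / (c - w ⬝ᵥ M⁻¹ *ᵥ w : ℝ)) ^ μ * Complex.Gamma μ) := by
  have h := integrable_firstRowFun hM hμ hc
  rw [Measure.volume_eq_prod] at h ⊢
  rw [integral_prod _ h]
  simp_rw [integral_firstRowFun_snd hM]
  rw [integral_indicator measurableSet_Ioi, integral_const_mul,
    Complex.integral_cpow_mul_exp_neg_mul_Ioi hμ hc]

/-- The integrand of the Laplace transform, in upper-triangular coordinates. -/
noncomputable def laplaceIntegrand (q : ℕ) (μ : ℂ) (y : Matrix (Fin q) (Fin q) ℝ) :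
    (SymIdx q → ℝ) → ℂ :=
  Set.indicator {c | (toSym q c).PosSemidef} fun c =>
    Complex.exp (-((toSym q c * y).trace : ℝ)) *
      ((toSym q c).det : ℂ) ^ (μ - ((q : ℂ) + 1) / 2)

theorem continuous_toSym (q : ℕ) : Continuous (toSym q) := by
  refine continuous_matrix fun i j => ?_
  unfold toSym
  split_ifs <;> fun_prop

theorem Matrix.isClosed_setOf_posSemidef (n : Type*) [Fintype n] :
    IsClosed {x : Matrix n n ℝ | x.PosSemidef} := by
  simp_rw [posSemidef_iff_dotProduct_mulVec, Set.ofPred_and, Set.ofPred_forall]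
  refine IsClosed.inter ?_ (isClosed_iInter fun v => ?_)
  · exact isClosed_eq (by fun_prop) continuous_id
  · exact isClosed_le continuous_const (by fun_prop)

theorem measurable_laplaceIntegrand (q : ℕ) (μ : ℂ) (y : Matrix (Fin q) (Fin q) ℝ) :
    Measurable (laplaceIntegrand q μ y) := by
  have h := continuous_toSym q
  refine Measurable.indicator (.mul ?_ (Measurable.pow_const ?_ _))
    ((isClosed_setOf_posSemidef (Fin q)).preimage h).measurableSet
  · exact (by fun_prop : Continuous fun c => Complex.exp (-((toSym q c * y).trace : ℝ))).measurable
  · exact (by fun_prop : Continuous fun c => ((toSym q c).det : ℂ)).measurable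

theorem laplaceIntegrand_schurMap (n : ℕ) (μ : ℂ) {y : Matrix (Fin (n + 1)) (Fin (n + 1)) ℝ}
    (hy : y.IsSymm) (p : (ℝ × (Fin n → ℝ)) × (SymIdx n → ℝ)) (hp : p.1.1 ≠ 0) :
    laplaceIntegrand (n + 1) μ y (schurMap n p) =
      firstRowFun (μ - ((n : ℂ) + 2) / 2) (y 0 0) (fun i => y i.succ 0)
        (y.submatrix Fin.succ Fin.succ) p.1 *
      laplaceIntegrand n (μ - 1 / 2) (y.submatrix Fin.succ Fin.succ) p.2 := by
  have hset := posSemidef_schurMap n p hp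
  unfold laplaceIntegrand firstRowFun
  by_cases h : 0 < p.1.1 ∧ (toSym n p.2).PosSemidef
  · rw [Set.indicator_of_mem (s := {c | (toSym (n + 1) c).PosSemidef}) (hset.mpr h),
      Set.indicator_of_mem (Set.mem_Ioi.mpr h.1),
      Set.indicator_of_mem (s := {c | (toSym n c).PosSemidef}) h.2, trace_schurMap_mul n p y hy,
      det_schurMap n p hp, Complex.ofReal_mul,
      Complex.mul_cpow_ofReal_nonneg h.1.le h.2.det_nonneg, Complex.ofReal_exp,
      show μ - (((n + 1 : ℕ) : ℂ) + 1) / 2 = μ - ((n : ℂ) + 2) / 2 by push_cast; ring,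
      show μ - 1 / 2 - ((n : ℂ) + 1) / 2 = μ - ((n : ℂ) + 2) / 2 by ring]
    rw [Complex.ofReal_add, neg_add, Complex.exp_add, Complex.ofReal_neg]
    ring
  · rw [Set.indicator_of_notMem (s := {c | (toSym (n + 1) c).PosSemidef}) (mt hset.mp h)]
    rw [not_and_or] at h
    rcases h with h | h
    · rw [Set.indicator_of_notMem (by simpa using h), zero_mul, zero_mul]
    · rw [Set.indicator_of_notMem (s := {c | (toSym n c).PosSemidef}) h, mul_zero]

theorem laplaceIntegrand_schurMap_ae (n : ℕ) (μ : ℂ)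
    {y : Matrix (Fin (n + 1)) (Fin (n + 1)) ℝ} (hy : y.IsSymm) :
    laplaceIntegrand (n + 1) μ y ∘ schurMap n =ᵐ[volume] fun p =>
      firstRowFun (μ - ((n : ℂ) + 2) / 2) (y 0 0) (fun i => y i.succ 0)
        (y.submatrix Fin.succ Fin.succ) p.1 *
      laplaceIntegrand n (μ - 1 / 2) (y.submatrix Fin.succ Fin.succ) p.2 := by
  have h : ∀ᵐ p : (ℝ × (Fin n → ℝ)) × (SymIdx n → ℝ), p.1.1 ≠ 0 :=
    (Measure.quasiMeasurePreserving_fst.comp Measure.quasiMeasurePreserving_fst).ae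
      (Measure.ae_ne volume 0)
  filter_upwards [h] with p hp using laplaceIntegrand_schurMap n μ hy p hp

theorem det_succ_eq_mul_det_submatrix {n : ℕ} {y : Matrix (Fin (n + 1)) (Fin (n + 1)) ℝ}
    (hy : y.IsSymm) (hM : IsUnit (y.submatrix Fin.succ Fin.succ).det) :
    y.det = (y.submatrix Fin.succ Fin.succ).det *
      (y 0 0 - (fun i => y i.succ 0) ⬝ᵥ
        (y.submatrix Fin.succ Fin.succ)⁻¹ *ᵥ fun i => y i.succ 0) := by
  have h : y.submatrix (headTailEquiv n) (headTailEquiv n) =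
      fromBlocks (of fun _ _ : Unit => y 0 0) (replicateRow Unit fun i => y i.succ 0)
        (replicateCol Unit fun i => y i.succ 0) (y.submatrix Fin.succ Fin.succ) := by
    ext (i | i) (j | j)
    · rfl
    · exact hy.apply _ _
    · rfl
    · rfl
  let := invertibleOfIsUnitDet _ hM
  rw [← det_submatrix_equiv_self (headTailEquiv n), h, det_fromBlocks₂₂, invOf_eq_nonsing_inv,
    Matrix.mul_assoc, ← replicateCol_mulVec, replicateRow_mul_replicateCol,
    det_unique (n := Unit)]
  rfl

theorem GammaOmegaC_succ (n : ℕ) (μ : ℂ) :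
    GammaOmegaC (n + 1) μ =
      ((√Real.pi ^ n : ℝ) : ℂ) * Complex.Gamma μ * GammaOmegaC n (μ - 1 / 2) := by
  have hπ : (Real.pi : ℂ) ≠ 0 := by exact_mod_cast Real.pi_ne_zero
  have h : (((n + 1) * (n + 1 - 1) : ℕ) : ℂ) / 4 = (n : ℂ) / 2 + ((n * (n - 1) : ℕ) : ℂ) / 4 := by
    cases n <;> push_cast [Nat.add_sub_cancel] <;> ring
  have hprod : ∏ j ∈ Finset.range n, Complex.Gamma (μ - ((j + 1 : ℕ) : ℂ) / 2) =
      ∏ j ∈ Finset.range n, Complex.Gamma (μ - 1 / 2 - (j : ℂ) / 2) :=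
    Finset.prod_congr rfl fun j _ => by congr 1; push_cast; ring
  rw [GammaOmegaC, GammaOmegaC, h, Complex.cpow_add _ _ hπ, Finset.prod_range_succ', hprod,
    Complex.ofReal_sqrt_pow Real.pi_pos.le]
  simp only [Nat.cast_zero, zero_div, sub_zero]
  ring

theorem laplaceIntegrand_integral (q : ℕ) : ∀ (μ : ℂ), ((q : ℝ) - 1) / 2 < μ.re →
    ∀ y : Matrix (Fin q) (Fin q) ℝ, y.PosDef →
      Integrable (laplaceIntegrand q μ y) ∧
        ∫ c, laplaceIntegrand q μ y c = GammaOmegaC q μ * (y.det : ℂ) ^ (-μ) := by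
  induction q with
  | zero =>
    intro μ _ y _
    have h : laplaceIntegrand 0 μ y = fun _ => 1 := by
      funext c
      have : (toSym 0 c).PosSemidef := by
        rw [Subsingleton.elim (toSym 0 c) 0]
        exact PosSemidef.zero
      rw [laplaceIntegrand, Set.indicator_of_mem (s := {c | (toSym 0 c).PosSemidef}) this]
      simp [trace]
    have hvol : (volume : Measure (SymIdx 0 → ℝ)) = Measure.dirac isEmptyElim :=
      Measure.pi_of_empty _
    rw [h, hvol]
    exact ⟨integrable_const _, by simp [GammaOmegaC]⟩
  | succ n ih =>
    intro μ hμ y hy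
    push_cast at hμ
    have hsymm : y.IsSymm := hy.isHermitian
    have hM : (y.submatrix Fin.succ Fin.succ).PosDef := hy.submatrix (Fin.succ_injective n)
    have hdet := det_succ_eq_mul_det_submatrix hsymm hM.det_pos.ne'.isUnit
    have hf := laplaceIntegrand_schurMap_ae n μ hsymm
    obtain ⟨hint, hval⟩ := ih (μ - 1 / 2)
      (by simp only [Complex.sub_re, Complex.div_ofNat_re, Complex.one_re]; linarith) _ hM
    have hμ0 : 0 < μ.re := by
      have : (0 : ℝ) ≤ n := n.cast_nonneg
      linarith
    generalize hw : (fun i : Fin n => y i.succ 0) = w at hdet hf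
    generalize y.submatrix Fin.succ Fin.succ = M at *
    generalize y 0 0 = c at hdet hf
    have hc : 0 < c - w ⬝ᵥ M⁻¹ *ᵥ w := by
      have := hy.det_pos
      rw [hdet] at this
      exact pos_of_mul_pos_right this hM.det_pos.le
    have hmp := measurePreserving_schurMap n
    have hmeas := (measurable_laplaceIntegrand (n + 1) μ y).aestronglyMeasurable (μ := volume)
    refine ⟨(hmp.integrable_comp hmeas).mp
      ((integrable_congr hf).mpr ((integrable_firstRowFun hM hμ0 hc).mul_prod hint)), ?_⟩
    have hM0 : (M.det : ℂ) ≠ 0 := by exact_mod_cast hM.det_pos.ne'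
    calc ∫ x, laplaceIntegrand (n + 1) μ y x
        = ∫ p, (laplaceIntegrand (n + 1) μ y ∘ schurMap n) p := by
          rw [← hmp.map_eq] at hmeas
          rw [← hmp.map_eq, integral_map hmp.aemeasurable hmeas]
          rfl
      _ = (∫ p, firstRowFun (μ - ((n : ℂ) + 2) / 2) c w M p) *
            ∫ x, laplaceIntegrand n (μ - 1 / 2) M x := by
          rw [integral_congr_ae hf, Measure.volume_eq_prod (ℝ × (Fin n → ℝ)), integral_prod_mul]
      _ = _ := by
          have hsqrt : ((√M.det : ℝ) : ℂ) = (M.det : ℂ) ^ (1 / 2 : ℂ) := by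
            simpa using Complex.ofReal_sqrt_pow hM.det_pos.le 1
          have hexp : (M.det : ℂ) ^ (-(μ - 1 / 2)) =
              (M.det : ℂ) ^ (-μ) * (M.det : ℂ) ^ (1 / 2 : ℂ) := by
            rw [← Complex.cpow_add _ _ hM0]
            ring_nf
          have hhalf : (M.det : ℂ) ^ (1 / 2 : ℂ) ≠ 0 := by
            simp [hM0]
          rw [integral_firstRowFun hM hμ0 hc, hval, GammaOmegaC_succ, hdet, Complex.ofReal_mul M.det,
            Complex.mul_cpow_ofReal_nonneg hM.det_pos.le hc.le, hexp, Complex.cpow_neg (_ - _ : ℝ),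
            ← Complex.inv_cpow, one_div]
          · push_cast [hsqrt]
            field_simp
          · rw [Complex.arg_ofReal_of_nonneg hc.le]
            exact Real.pi_pos.ne

instance matrixBorelSpace (q : ℕ) : BorelSpace (Matrix (Fin q) (Fin q) ℝ) :=
  inferInstanceAs (BorelSpace (Fin q → Fin q → ℝ))

/-- For `Re μ > (q−1)/2` and `y` positive definite, the Laplace transform
identity `∫_{Π_q} e^{−⟨x,y⟩} det(x)^{μ−(q+1)/2} dx = Γ_Ω(μ) det(y)^{−μ}` holds. -/
theorem stmt8 (q : ℕ) (μ : ℂ) (hμ : ((q : ℝ) - 1) / 2 < μ.re)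
    (y : Matrix (Fin q) (Fin q) ℝ) (hy : y.PosDef) :
    ∫ x in {x : Matrix (Fin q) (Fin q) ℝ | x.PosSemidef},
        Complex.exp (-((x * y).trace : ℝ)) * (x.det : ℂ) ^ (μ - ((q : ℂ) + 1) / 2)
        ∂(symMeasure q)
      = GammaOmegaC q μ * (y.det : ℂ) ^ (-μ) := by
  have hset : MeasurableSet {x : Matrix (Fin q) (Fin q) ℝ | x.PosSemidef} :=
    (isClosed_setOf_posSemidef (Fin q)).measurableSet
  have hmeas : Measurable fun x : Matrix (Fin q) (Fin q) ℝ =>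
      Complex.exp (-((x * y).trace : ℝ)) * (x.det : ℂ) ^ (μ - ((q : ℂ) + 1) / 2) := by
    refine .mul ?_ (Measurable.pow_const ?_ _)
    · exact (by fun_prop : Continuous fun x : Matrix (Fin q) (Fin q) ℝ =>
        Complex.exp (-((x * y).trace : ℝ))).measurable
    · exact (by fun_prop : Continuous fun x : Matrix (Fin q) (Fin q) ℝ =>
        (x.det : ℂ)).measurable
  rw [← integral_indicator hset, symMeasure,
    integral_map (continuous_toSym q).measurable.aemeasurable
      (hmeas.indicator hset).aestronglyMeasurable]
  exact (laplaceIntegrand_integral q μ hμ y hy).2
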